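/- Assume M is ∞-spanned and the indexing of the generators is adapted as in the Labelling lemma. Then for every reachable state D of the geodesic automaton Geo with D ≠ ∅ (and D not the fail state), there exists a word u over the alphabet {1, …, n} such that all transitions along u starting from D are defined and δ̂(D, u) = {α_1}. -/

import Mathlib

open scoped BigOperators

/-- The simple root `α_i`, the `i`-th standard basis vector of `ℝ^n`. -/
noncomputable def simpleRoot {n : ℕ} (i : Fin n) : Fin n → ℝ := Pi.single i 1

/-- The symmetric bilinear form `B` associated to the Coxeter matrix `M`, determined by
`B(α_i, α_j) = -cos (π / M i j)` when `M i j ≠ 0` and `B(α_i, α_j) = -1` when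
`M i j = 0` (the label `∞`). -/
noncomputable def bform {n : ℕ} (M : CoxeterMatrix (Fin n)) (u v : Fin n → ℝ) : ℝ :=
  ∑ i, ∑ j, u i * (if M i j = 0 then -1 else -Real.cos (Real.pi / (M i j))) * v j

/-- The simple reflection `σ_i(v) = v - 2 B(v, α_i) α_i`. -/
noncomputable def simpleRefl {n : ℕ} (M : CoxeterMatrix (Fin n)) (i : Fin n)
    (v : Fin n → ℝ) : Fin n → ℝ :=
  v - (2 * bform M v (simpleRoot i)) • simpleRoot i

/-- The set `Σ` of small roots of `M`: the smallest set of vectors containing the simple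
roots `α_1, …, α_n` and such that whenever `v ∈ Σ` and `-1 < B(v, α_i) < 0`, also
`σ_i(v) ∈ Σ`. -/
inductive IsSmallRoot {n : ℕ} (M : CoxeterMatrix (Fin n)) : (Fin n → ℝ) → Prop
  | simple (i : Fin n) : IsSmallRoot M (simpleRoot i)
  | reflect {v : Fin n → ℝ} (i : Fin n) : IsSmallRoot M v →
      -1 < bform M v (simpleRoot i) → bform M v (simpleRoot i) < 0 →
      IsSmallRoot M (simpleRefl M i v)

/-- The transition function of the geodesic automaton `Geo` (defined when `α_i ∉ D`):
`δ(D, i) = {α_i} ∪ (σ_i(D) ∩ Σ)`. -/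
noncomputable def stepGeo {n : ℕ} (M : CoxeterMatrix (Fin n)) (D : Set (Fin n → ℝ))
    (i : Fin n) : Set (Fin n → ℝ) :=
  insert (simpleRoot i) (simpleRefl M i '' D ∩ {v | IsSmallRoot M v})

/-- The transition function of the shortlex automaton `ShortLex` (defined when `α_i ∉ D`):
`δ(D, i) = {α_i} ∪ ((σ_i(D) ∪ {σ_i(α_l) : l < i}) ∩ Σ)`. -/
noncomputable def stepSL {n : ℕ} (M : CoxeterMatrix (Fin n)) (D : Set (Fin n → ℝ))
    (i : Fin n) : Set (Fin n → ℝ) :=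
  insert (simpleRoot i)
    ((simpleRefl M i '' D ∪ simpleRefl M i '' {v | ∃ l : Fin n, l < i ∧ v = simpleRoot l})
      ∩ {v | IsSmallRoot M v})

/-- All transitions of the automaton with transition function `step` are defined (do not
fail) when reading the word `u` from the state `D`; a transition out of `D` along the letter
`i` is defined exactly when `α_i ∉ D`. -/
def DefinedFrom {n : ℕ} (step : Set (Fin n → ℝ) → Fin n → Set (Fin n → ℝ)) :
    Set (Fin n → ℝ) → List (Fin n) → Prop
  | _, [] => True
  | D, i :: u => simpleRoot i ∉ D ∧ DefinedFrom step (step D i) u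

/-- The enhanced transition function `δ̂(D, u)`: the state obtained by reading the word `u`
from the state `D`. -/
def run {n : ℕ} (step : Set (Fin n → ℝ) → Fin n → Set (Fin n → ℝ))
    (D : Set (Fin n → ℝ)) (u : List (Fin n)) : Set (Fin n → ℝ) :=
  u.foldl step D

/-- A state is reachable if it is obtained from the start state `∅` by reading some word all
of whose transitions are defined. -/
def Reachable {n : ℕ} (step : Set (Fin n → ℝ) → Fin n → Set (Fin n → ℝ))
    (D : Set (Fin n → ℝ)) : Prop :=
  ∃ u : List (Fin n), DefinedFrom step ∅ u ∧ run step ∅ u = D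

/-- The graph of `∞`-edges of the Coxeter matrix `M`: `i ≠ j` are adjacent iff `M i j = 0`. -/
def infGraph {n : ℕ} (M : CoxeterMatrix (Fin n)) : SimpleGraph (Fin n) :=
  SimpleGraph.fromRel (fun i j => M i j = 0)

/-- The indexing of the generators is adapted as in the Labelling lemma: there is a spanning
tree `Γ` of the graph of `∞`-edges containing the edges `{1,2}` and `{2,3}`, such that along
every simple path in `Γ` from the vertex `1` to a leaf of `Γ` the labels strictly increase.
(Vertices `1, 2, 3` correspond to the indices `0, 1, 2` of `Fin n`.) -/
def AdaptedLabelling {n : ℕ} (hn : 3 ≤ n) (M : CoxeterMatrix (Fin n)) : Prop :=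
  ∃ Γ : SimpleGraph (Fin n), Γ ≤ infGraph M ∧ Γ.Connected ∧ Γ.IsAcyclic ∧
    Γ.Adj ⟨0, by omega⟩ ⟨1, by omega⟩ ∧ Γ.Adj ⟨1, by omega⟩ ⟨2, by omega⟩ ∧
    ∀ (v : Fin n) (p : Γ.Walk ⟨0, by omega⟩ v), p.IsPath → (∃! w : Fin n, Γ.Adj v w) →
      p.support.Chain' (· < ·)

/-- The entry `B(α_i, α_j)` of the Gram matrix of the simple roots. -/
noncomputable def gramEntry {n : ℕ} (M : CoxeterMatrix (Fin n)) (i j : Fin n) : ℝ :=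
  if M i j = 0 then -1 else -Real.cos (Real.pi / (M i j))

section SmallRoots

variable {n : ℕ} {M : CoxeterMatrix (Fin n)}

lemma gramEntry_self (i : Fin n) : gramEntry M i i = 1 := by
  simp [gramEntry]

lemma gramEntry_of_eq_zero {i j : Fin n} (h : M i j = 0) : gramEntry M i j = -1 := by
  simp [gramEntry, h]

lemma gramEntry_eq_zero_or_le {i j : Fin n} (h : i ≠ j) :
    gramEntry M i j = 0 ∨ gramEntry M i j ≤ -1 / 2 := by
  unfold gramEntry
  split_ifs with h0
  · right; norm_num
  · have h1 : M i j ≠ 1 := M.off_diagonal i j h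
    rcases Nat.lt_or_ge 2 (M i j) with h3 | h3
    · right
      have h3' : (3 : ℝ) ≤ (M i j : ℝ) := by exact_mod_cast h3
      have hle : Real.pi / (M i j) ≤ Real.pi / 3 := by
        have := Real.pi_pos
        gcongr
      have hcos := Real.cos_le_cos_of_nonneg_of_le_pi
        (by positivity : (0 : ℝ) ≤ Real.pi / (M i j)) (by linarith [Real.pi_pos]) hle
      rw [Real.cos_pi_div_three] at hcos
      linarith
    · left
      have h2 : M i j = 2 := by omega
      simp [h2]

lemma gramEntry_nonpos {i j : Fin n} (h : i ≠ j) : gramEntry M i j ≤ 0 := by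
  rcases gramEntry_eq_zero_or_le (M := M) h with h | h <;> linarith

lemma bform_simpleRoot (v : Fin n → ℝ) (i : Fin n) :
    bform M v (simpleRoot i) = ∑ k, v k * gramEntry M k i := by
  unfold bform
  refine Finset.sum_congr rfl fun k _ => ?_
  rw [Finset.sum_eq_single i]
  · simp [simpleRoot, gramEntry]
  · intro j _ hj
    simp [simpleRoot, hj]
  · simp

lemma bform_simpleRoot_simpleRoot (i j : Fin n) :
    bform M (simpleRoot i) (simpleRoot j) = gramEntry M i j := by
  rw [bform_simpleRoot, Finset.sum_eq_single i]
  · simp [simpleRoot]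
  · intro k _ hk
    simp [simpleRoot, hk]
  · simp

lemma simpleRefl_apply_self (i : Fin n) (v : Fin n → ℝ) :
    simpleRefl M i v i = v i - 2 * bform M v (simpleRoot i) := by
  simp [simpleRefl, simpleRoot]

lemma simpleRefl_apply_of_ne {i k : Fin n} (h : k ≠ i) (v : Fin n → ℝ) :
    simpleRefl M i v k = v k := by
  simp [simpleRefl, simpleRoot, h]

lemma bform_simpleRefl_self (i : Fin n) (v : Fin n → ℝ) :
    bform M (simpleRefl M i v) (simpleRoot i) = -bform M v (simpleRoot i) := by
  have h : bform M (simpleRefl M i v) (simpleRoot i) = bform M v (simpleRoot i) -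
      2 * bform M v (simpleRoot i) * bform M (simpleRoot i) (simpleRoot i) := by
    conv_lhs => rw [bform_simpleRoot]
    conv_rhs => rw [bform_simpleRoot (simpleRoot i) i, Finset.mul_sum]
    conv_rhs => lhs; rw [bform_simpleRoot]
    rw [← Finset.sum_sub_distrib]
    refine Finset.sum_congr rfl fun k _ => ?_
    simp only [simpleRefl, Pi.sub_apply, Pi.smul_apply, smul_eq_mul]
    ring
  rw [h, bform_simpleRoot_simpleRoot, gramEntry_self]
  ring

lemma simpleRefl_simpleRefl (i : Fin n) (v : Fin n → ℝ) :
    simpleRefl M i (simpleRefl M i v) = v := by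
  rw [simpleRefl, bform_simpleRefl_self, simpleRefl]
  module

lemma simpleRefl_eq_self {i : Fin n} {v : Fin n → ℝ} (hv : v i = 0)
    (h : simpleRefl M i v i = 0) : simpleRefl M i v = v := by
  ext k
  by_cases hk : k = i
  · rw [hk, h, hv]
  · exact simpleRefl_apply_of_ne hk v

/-- If `v` has nonnegative coordinates and `v i = 0`, then `B(v, α_i)` is at most any single term
of its expansion. -/
lemma bform_simpleRoot_le {v : Fin n → ℝ} (hv : ∀ k, 0 ≤ v k) {i : Fin n} (hi : v i = 0)
    (j : Fin n) : bform M v (simpleRoot i) ≤ v j * gramEntry M j i := by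
  rw [bform_simpleRoot, ← Finset.add_sum_erase _ _ (Finset.mem_univ j)]
  have : ∑ k ∈ Finset.univ.erase j, v k * gramEntry M k i ≤ 0 := by
    refine Finset.sum_nonpos fun k _ => ?_
    by_cases hk : k = i
    · simp [hk, hi]
    · exact mul_nonpos_of_nonneg_of_nonpos (hv k) (gramEntry_nonpos hk)
  linarith

/-- The coordinates of a small root are `0` or at least `1`, they are not all zero, and the support
of a small root contains no edge labelled `∞`. -/
lemma IsSmallRoot.coord {v : Fin n → ℝ} (hv : IsSmallRoot M v) :
    (∀ k, v k = 0 ∨ 1 ≤ v k) ∧ (∃ k, v k ≠ 0) ∧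
      ∀ i j, M i j = 0 → v i = 0 ∨ v j = 0 := by
  induction hv with
  | simple i =>
    refine ⟨fun k => ?_, ⟨i, by simp [simpleRoot]⟩, fun k j hkj => ?_⟩
    · by_cases hk : k = i <;> simp [simpleRoot, hk]
    · by_cases hk : k = i
      · right
        have hj : j ≠ i := by
          rintro rfl
          simp [hk] at hkj
        simp [simpleRoot, hj]
      · left
        simp [simpleRoot, hk]
  | @reflect v i _ hgt hlt ih =>
    obtain ⟨hcoord, ⟨m, hm⟩, hsupp⟩ := ih
    have hnonneg : ∀ k, 0 ≤ v k := fun k => by rcases hcoord k with h | h <;> linarith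
    have hself : 1 ≤ simpleRefl M i v i := by
      rw [simpleRefl_apply_self]
      rcases hcoord i with hi | hi
      · obtain ⟨k, -, hk⟩ : ∃ k ∈ Finset.univ, v k * gramEntry M k i < 0 := by
          by_contra! hcon
          have := Finset.sum_nonneg hcon
          rw [← bform_simpleRoot] at this
          linarith
        have hki : k ≠ i := by
          rintro rfl
          simp [hi] at hk
        have hle := bform_simpleRoot_le (M := M) hnonneg hi k
        have hk1 : 1 ≤ v k := (hcoord k).resolve_left fun h0 => by simp [h0] at hk
        have hg : gramEntry M k i ≤ -1 / 2 :=
          (gramEntry_eq_zero_or_le hki).resolve_left fun h0 => by simp [h0] at hk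
        nlinarith
      · linarith
    have hedge : ∀ j, M j i = 0 → v j = 0 := by
      intro j hj
      by_contra hne
      have hj1 := (hcoord j).resolve_left hne
      have hle := bform_simpleRoot_le (M := M) hnonneg ((hsupp j i hj).resolve_left hne) j
      rw [gramEntry_of_eq_zero hj] at hle
      linarith
    refine ⟨fun k => ?_, ⟨i, by linarith⟩, fun k j hkj => ?_⟩
    · by_cases hk : k = i
      · rw [hk]; exact Or.inr hself
      · rw [simpleRefl_apply_of_ne hk]; exact hcoord k
    · by_cases hk : k = i
      · right
        subst hk
        have hj : j ≠ k := by
          rintro rfl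
          simp at hkj
        rw [simpleRefl_apply_of_ne hj]
        exact hedge j (by rw [M.symmetric]; exact hkj)
      · by_cases hj : j = i
        · subst hj
          left
          rw [simpleRefl_apply_of_ne hk]
          exact hedge k hkj
        · rw [simpleRefl_apply_of_ne hk, simpleRefl_apply_of_ne hj]
          exact hsupp k j hkj

/-- If a small root stays small after applying `σ_i`, then its support avoids every neighbour of
`i` along an edge labelled `∞`. -/
lemma IsSmallRoot.apply_eq_zero {v : Fin n → ℝ} {i j : Fin n} (hij : M i j = 0)
    (hv : IsSmallRoot M v) (hr : IsSmallRoot M (simpleRefl M i v)) : v j = 0 := by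
  by_contra hne
  have hji : j ≠ i := by
    rintro rfl
    simp at hij
  obtain ⟨hcoord, -, hsupp⟩ := hv.coord
  have hi := (hsupp i j hij).resolve_right hne
  have hj1 := (hcoord j).resolve_left hne
  have hri := (hr.coord.2.2 i j hij).resolve_right (by rwa [simpleRefl_apply_of_ne hji])
  rw [simpleRefl_apply_self, hi] at hri
  have hle := bform_simpleRoot_le (M := M)
    (fun k => by rcases hcoord k with h | h <;> linarith) hi j
  rw [gramEntry_of_eq_zero (by rw [M.symmetric]; exact hij)] at hle
  linarith

lemma not_isSmallRoot_simpleRefl_simpleRoot {i j : Fin n} (hij : M i j = 0) :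
    ¬ IsSmallRoot M (simpleRefl M i (simpleRoot j)) := fun h => by
  have := IsSmallRoot.apply_eq_zero hij (.simple j) h
  simp [simpleRoot] at this

/-- A small root that stays small under `σ_i σ_j σ_i σ_j`, for an edge `{i, j}` labelled `∞`, is
fixed by `σ_i` and `σ_j`. -/
lemma IsSmallRoot.fixed_of_alternating {v : Fin n → ℝ} {i j : Fin n} (hij : M i j = 0)
    (h₀ : IsSmallRoot M v) (h₁ : IsSmallRoot M (simpleRefl M j v))
    (h₂ : IsSmallRoot M (simpleRefl M i (simpleRefl M j v)))
    (h₃ : IsSmallRoot M (simpleRefl M j (simpleRefl M i (simpleRefl M j v))))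
    (h₄ : IsSmallRoot M (simpleRefl M i (simpleRefl M j (simpleRefl M i (simpleRefl M j v))))) :
    v i = 0 ∧ simpleRefl M i v = v ∧ simpleRefl M j v = v := by
  have hji : M j i = 0 := by rw [M.symmetric]; exact hij
  have hne : i ≠ j := by
    rintro rfl
    simp at hij
  have hvi : v i = 0 := h₀.apply_eq_zero hji h₁
  have hi : simpleRefl M i (simpleRefl M j v) = simpleRefl M j v :=
    simpleRefl_eq_self (by rwa [simpleRefl_apply_of_ne hne]) (h₂.apply_eq_zero hji h₃)
  rw [hi, simpleRefl_simpleRefl] at h₄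
  have hj : simpleRefl M j v = v :=
    simpleRefl_eq_self (h₀.apply_eq_zero hij h₄) (h₁.apply_eq_zero hij h₂)
  exact ⟨hvi, by rwa [hj] at hi, hj⟩

end SmallRoots

section Automaton

variable {n : ℕ} {M : CoxeterMatrix (Fin n)}

/-- The state `D'` can be reached from `D` by a word all of whose transitions are defined. -/
def CanReach {n : ℕ} (step : Set (Fin n → ℝ) → Fin n → Set (Fin n → ℝ))
    (D D' : Set (Fin n → ℝ)) : Prop :=
  ∃ u : List (Fin n), DefinedFrom step D u ∧ run step D u = D'

lemma CanReach.refl {step : Set (Fin n → ℝ) → Fin n → Set (Fin n → ℝ)}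
    (D : Set (Fin n → ℝ)) : CanReach step D D :=
  ⟨[], trivial, rfl⟩

lemma definedFrom_append {step : Set (Fin n → ℝ) → Fin n → Set (Fin n → ℝ)}
    (D : Set (Fin n → ℝ)) (u v : List (Fin n)) :
    DefinedFrom step D (u ++ v) ↔ DefinedFrom step D u ∧ DefinedFrom step (run step D u) v := by
  induction u generalizing D with
  | nil => simp [DefinedFrom, run]
  | cons i u ih => simp [DefinedFrom, run, ih, and_assoc]

lemma CanReach.trans {step : Set (Fin n → ℝ) → Fin n → Set (Fin n → ℝ)}
    {D D' D'' : Set (Fin n → ℝ)} (h : CanReach step D D') (h' : CanReach step D' D'') :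
    CanReach step D D'' := by
  obtain ⟨u, hu, rfl⟩ := h
  obtain ⟨v, hv, rfl⟩ := h'
  exact ⟨u ++ v, (definedFrom_append _ _ _).2 ⟨hu, hv⟩, by simp [run]⟩

/-- A set of small roots containing no simple root adjacent to `α_i` along an edge labelled
`∞`. -/
def IsTail (M : CoxeterMatrix (Fin n)) (i : Fin n) (E : Set (Fin n → ℝ)) : Prop :=
  (∀ v ∈ E, IsSmallRoot M v) ∧ ∀ j, M i j = 0 → simpleRoot j ∉ E

lemma isTail_image {E : Set (Fin n → ℝ)} (hE : ∀ v ∈ E, IsSmallRoot M v) (i : Fin n) :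
    IsTail M i (simpleRefl M i '' E ∩ {v | IsSmallRoot M v}) := by
  refine ⟨fun v hv => hv.2, ?_⟩
  rintro j hij ⟨⟨v, hv, hvj⟩, -⟩
  apply not_isSmallRoot_simpleRefl_simpleRoot hij
  rw [← hvj, simpleRefl_simpleRefl]
  exact hE v hv

lemma IsTail.canReach_image {i j : Fin n} (hij : M i j = 0) {E : Set (Fin n → ℝ)}
    (hE : IsTail M i E) :
    CanReach (stepGeo M) (insert (simpleRoot i) E)
      (insert (simpleRoot j) (simpleRefl M j '' E ∩ {v | IsSmallRoot M v})) := by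
  have hji : M j i = 0 := by rw [M.symmetric]; exact hij
  refine ⟨[j], ⟨?_, trivial⟩, ?_⟩
  · rintro (h | h)
    · have := congrFun h j
      have hne : j ≠ i := by
        rintro rfl
        simp at hij
      simp [simpleRoot, hne] at this
    · exact hE.2 j hij h
  · simp only [run, List.foldl_cons, List.foldl_nil, stepGeo, Set.image_insert_eq]
    rw [Set.insert_inter_of_notMem]
    exact not_isSmallRoot_simpleRefl_simpleRoot hji

/-- Moving along an edge labelled `∞` while removing every root not vanishing at the start. -/
lemma IsTail.exists_canReach_of_adj {i j : Fin n} (hij : M i j = 0) {E : Set (Fin n → ℝ)}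
    (hE : IsTail M i E) :
    ∃ E', IsTail M j E' ∧ (∀ v ∈ E', v ∈ E ∧ v i = 0) ∧
      CanReach (stepGeo M) (insert (simpleRoot i) E) (insert (simpleRoot j) E') := by
  have hji : M j i = 0 := by rw [M.symmetric]; exact hij
  have t₁ := isTail_image hE.1 j
  have t₂ := isTail_image t₁.1 i
  have t₃ := isTail_image t₂.1 j
  have t₄ := isTail_image t₃.1 i
  refine ⟨_, isTail_image t₄.1 j, ?_, (hE.canReach_image hij).trans <|
    (t₁.canReach_image hji).trans <| (t₂.canReach_image hij).trans <|
    (t₃.canReach_image hji).trans (t₄.canReach_image hij)⟩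
  rintro _ ⟨⟨_, ⟨⟨_, ⟨⟨_, ⟨⟨_, ⟨⟨v, hv, rfl⟩, h₁⟩, rfl⟩, h₂⟩, rfl⟩, h₃⟩, rfl⟩, h₄⟩, rfl⟩, -⟩
  obtain ⟨hvi, hi, hj⟩ := (hE.1 v hv).fixed_of_alternating hij h₁ h₂ h₃ h₄
  rw [hj, hi, hj, hi, hj]
  exact ⟨hv, hvi⟩

lemma eq_zero_of_infGraph_adj {i j : Fin n} (h : (infGraph M).Adj i j) : M i j = 0 := by
  obtain ⟨-, h | h⟩ := h
  · exact h
  · rw [M.symmetric]; exact h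

lemma IsTail.exists_canReach_of_walk {i k : Fin n} (p : (infGraph M).Walk i k)
    {E : Set (Fin n → ℝ)} (hE : IsTail M i E) :
    ∃ E', IsTail M k E' ∧ E' ⊆ E ∧
      CanReach (stepGeo M) (insert (simpleRoot i) E) (insert (simpleRoot k) E') := by
  induction p generalizing E with
  | nil => exact ⟨E, hE, subset_rfl, .refl _⟩
  | cons h _ ih =>
    obtain ⟨E₁, t₁, s₁, r₁⟩ := hE.exists_canReach_of_adj (eq_zero_of_infGraph_adj h)
    obtain ⟨E₂, t₂, s₂, r₂⟩ := ih t₁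
    exact ⟨E₂, t₂, fun v hv => (s₁ v (s₂ hv)).1, r₁.trans r₂⟩

lemma IsTail.exists_canReach_vanishing [Nontrivial (Fin n)] (hspan : (infGraph M).Connected)
    {i : Fin n} {E : Set (Fin n → ℝ)} (hE : IsTail M i E) (s : Finset (Fin n)) :
    ∃ j E', IsTail M j E' ∧ (∀ v ∈ E', ∀ k ∈ s, v k = 0) ∧
      CanReach (stepGeo M) (insert (simpleRoot i) E) (insert (simpleRoot j) E') := by
  induction s using Finset.induction_on with
  | empty => exact ⟨i, E, hE, by simp, .refl _⟩
  | insert k s _ ih =>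
    obtain ⟨j, E₁, t₁, s₁, r₁⟩ := ih
    obtain ⟨p⟩ := hspan.preconnected j k
    obtain ⟨E₂, t₂, s₂, r₂⟩ := t₁.exists_canReach_of_walk p
    obtain ⟨l, hl⟩ := hspan.preconnected.exists_adj_of_nontrivial k
    obtain ⟨E₃, t₃, s₃, r₃⟩ := t₂.exists_canReach_of_adj (eq_zero_of_infGraph_adj hl)
    refine ⟨l, E₃, t₃, fun v hv m hm => ?_, r₁.trans (r₂.trans r₃)⟩
    rcases Finset.mem_insert.1 hm with rfl | hm
    · exact (s₃ v hv).2
    · exact s₁ v (s₂ (s₃ v hv).1) m hm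

lemma IsTail.canReach_singleton [Nontrivial (Fin n)] (hspan : (infGraph M).Connected)
    {i : Fin n} {E : Set (Fin n → ℝ)} (hE : IsTail M i E) (k : Fin n) :
    CanReach (stepGeo M) (insert (simpleRoot i) E) {simpleRoot k} := by
  obtain ⟨j, E₁, t₁, s₁, r₁⟩ := hE.exists_canReach_vanishing hspan Finset.univ
  have hempty : E₁ = ∅ := Set.eq_empty_of_forall_notMem fun v hv => by
    obtain ⟨m, hm⟩ := (t₁.1 v hv).coord.2.1
    exact hm (s₁ v hv m (Finset.mem_univ m))
  obtain ⟨p⟩ := hspan.preconnected j k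
  obtain ⟨E₂, -, s₂, r₂⟩ := t₁.exists_canReach_of_walk p
  rw [hempty, Set.subset_empty_iff] at s₂
  rw [s₂, insert_empty_eq] at r₂
  exact r₁.trans r₂

lemma isSmallRoot_of_mem_stepGeo {D : Set (Fin n → ℝ)} {i : Fin n} {v : Fin n → ℝ}
    (hv : v ∈ stepGeo M D i) : IsSmallRoot M v := by
  rcases hv with rfl | hv
  · exact .simple i
  · exact hv.2

lemma isSmallRoot_of_mem_run (u : List (Fin n)) {v : Fin n → ℝ}
    (hv : v ∈ run (stepGeo M) ∅ u) : IsSmallRoot M v := by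
  induction u using List.reverseRecOn with
  | nil => simp [run] at hv
  | append_singleton u i _ =>
    rw [run, List.foldl_append] at hv
    exact isSmallRoot_of_mem_stepGeo hv

lemma Reachable.exists_isTail {D : Set (Fin n → ℝ)} (h : Reachable (stepGeo M) D) (hD : D ≠ ∅) :
    ∃ i E, IsTail M i E ∧ D = insert (simpleRoot i) E := by
  obtain ⟨u, -, rfl⟩ := h
  induction u using List.reverseRecOn with
  | nil => simp [run] at hD
  | append_singleton u i _ =>
    exact ⟨i, _, isTail_image (fun v hv => isSmallRoot_of_mem_run u hv) i, by
      simp [run, stepGeo]⟩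

end Automaton

/-- **Hydra's lemma** for the geo automaton: if `M` is `∞`-spanned and the indexing is
adapted as in the Labelling lemma, then from every reachable nonempty (non-fail) state `D`
one can reach the state `{α_1}` by reading some word all of whose transitions are defined. -/
theorem hydra_geo {n : ℕ} (hn : 3 ≤ n) (M : CoxeterMatrix (Fin n))
    (hspan : (infGraph M).Connected) (hadapt : AdaptedLabelling hn M) :
    ∀ D : Set (Fin n → ℝ), Reachable (stepGeo M) D → D ≠ ∅ →
      ∃ u : List (Fin n), DefinedFrom (stepGeo M) D u ∧
        run (stepGeo M) D u = {simpleRoot (⟨0, by omega⟩ : Fin n)} := by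
  intro D hD hne
  have : Nontrivial (Fin n) := Fin.nontrivial_iff_two_le.2 (by omega)
  obtain ⟨i, E, hE, rfl⟩ := hD.exists_isTail hne
  exact hE.canReach_singleton hspan _
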